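/- arXiv:1903.00262 — 2 statements merged into one kernel-verified Lean document; each statement's English description precedes it below -/
import Mathlib

section
/- Let q ≥ 1 and let α⃗ = (α_1,…,α_{q−1}), β⃗ = (β_1,…,β_{q−1}) be multi-indices with entries in {1,…,p}, and let P be the polynomial with 𝒟_{α_1}⋯𝒟_{α_{q−1}} 𝒟̄_{β_1}⋯𝒟̄_{β_{q−1}} φ₀ = P(z,z̄)·φ₀. Then the constant term P(0) is nonzero if and only if every index α ∈ {1,…,p} occurs with the same multiplicity in α⃗ as in β⃗; and in that case P(0) = 2^{q−1} (−1/π)^{q−1} ∏_{α ∈ α⃗} m(α)!, where m(α) is the multiplicity of α in α⃗ and the product runs over the distinct entries of α⃗. -/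
open Complex Finset

noncomputable section

/-- Wirtinger derivative `∂/∂z_α` of a function `f : ℂ^p → ℂ`. -/
def wderiv (p : ℕ) (α : Fin p) (f : (Fin p → ℂ) → ℂ) : (Fin p → ℂ) → ℂ :=
  fun z => (1/2) * (fderiv ℝ f z (Pi.single α 1) - Complex.I * fderiv ℝ f z (Pi.single α Complex.I))

/-- Wirtinger derivative `∂/∂z̄_α` of a function `f : ℂ^p → ℂ`. -/
def wderivBar (p : ℕ) (α : Fin p) (f : (Fin p → ℂ) → ℂ) : (Fin p → ℂ) → ℂ :=
  fun z => (1/2) * (fderiv ℝ f z (Pi.single α 1) + Complex.I * fderiv ℝ f z (Pi.single α Complex.I))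

/-- The operator `𝒟_α f = z̄_α·f − (1/π) ∂f/∂z_α`. -/
def Dop (p : ℕ) (α : Fin p) (f : (Fin p → ℂ) → ℂ) : (Fin p → ℂ) → ℂ :=
  fun z => (starRingEnd ℂ) (z α) * f z - (1/(Real.pi : ℂ)) * wderiv p α f z

/-- The operator `𝒟̄_α f = z_α·f − (1/π) ∂f/∂z̄_α`. -/
def DopBar (p : ℕ) (α : Fin p) (f : (Fin p → ℂ) → ℂ) : (Fin p → ℂ) → ℂ :=
  fun z => z α * f z - (1/(Real.pi : ℂ)) * wderivBar p α f z

/-- The standard Gaussian `φ₀(z) = exp(−π Σ_α |z_α|²)` on `ℂ^p`. -/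
def gaussian (p : ℕ) : (Fin p → ℂ) → ℂ :=
  fun z => Complex.exp (-(Real.pi : ℂ) * ∑ α, (Complex.normSq (z α) : ℂ))

/-- The coordinates `z_a` (`Sum.inl a`) and `z̄_a` (`Sum.inr a`) as real-linear functionals. -/
def coordCLM (p : ℕ) : Fin p ⊕ Fin p → ((Fin p → ℂ) →L[ℝ] ℂ) :=
  Sum.elim (fun a => ContinuousLinearMap.proj a)
    (fun a => (Complex.conjCLE : ℂ →L[ℝ] ℂ).comp (ContinuousLinearMap.proj a))

@[simp] lemma coordCLM_inl (p : ℕ) (a : Fin p) (z : Fin p → ℂ) :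
    coordCLM p (Sum.inl a) z = z a := rfl

@[simp] lemma coordCLM_inr (p : ℕ) (a : Fin p) (z : Fin p → ℂ) :
    coordCLM p (Sum.inr a) z = (starRingEnd ℂ) (z a) := rfl

lemma hasFDerivAt_eval_clm {E σ : Type*} [NormedAddCommGroup E] [NormedSpace ℝ E] [Fintype σ]
    (c : σ → (E →L[ℝ] ℂ)) (Q : MvPolynomial σ ℂ) (z : E) :
    HasFDerivAt (fun z => MvPolynomial.eval (fun i => c i z) Q)
      (∑ i, MvPolynomial.eval (fun i => c i z) (MvPolynomial.pderiv i Q) • c i) z := by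
  classical
  induction Q using MvPolynomial.induction_on with
  | C r =>
    simp only [MvPolynomial.eval_C]
    refine (hasFDerivAt_const (𝕜 := ℝ) r z).congr_fderiv ?_
    ext v
    simp
  | add f g hf hg =>
    simp only [map_add]
    refine (hf.fun_add hg).congr_fderiv ?_
    ext v
    simp [add_mul, Finset.sum_add_distrib]
  | mul_X f j hf =>
    have h := hf.mul (c j).hasFDerivAt
    simp only [map_mul, MvPolynomial.eval_X]
    refine h.congr_fderiv ?_
    ext v
    simp [MvPolynomial.pderiv_X, Pi.single_apply, add_mul, Finset.sum_add_distrib,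
      Finset.mul_sum, apply_ite]
    grind

/-- The function `Q(z, z̄) φ₀(z)` attached to a polynomial `Q`. -/
def polyGaussian (p : ℕ) (Q : MvPolynomial (Fin p ⊕ Fin p) ℂ) : (Fin p → ℂ) → ℂ :=
  fun z => MvPolynomial.eval (fun i => coordCLM p i z) Q * gaussian p z

lemma hasFDerivAt_gaussian (p : ℕ) (z : Fin p → ℂ) :
    HasFDerivAt (gaussian p)
      ((-(Real.pi : ℂ) * gaussian p z) • ∑ a, ((starRingEnd ℂ) (z a) • coordCLM p (Sum.inl a)
        + z a • coordCLM p (Sum.inr a))) z := by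
  have h : HasFDerivAt (fun z : Fin p → ℂ => ∑ a, (Complex.normSq (z a) : ℂ))
      (∑ a, ((starRingEnd ℂ) (z a) • coordCLM p (Sum.inl a)
        + z a • coordCLM p (Sum.inr a))) z := by
    refine HasFDerivAt.fun_sum fun a _ => ?_
    simp only [Complex.normSq_eq_conj_mul_self]
    have := (coordCLM p (Sum.inr a)).hasFDerivAt (x := z) |>.mul
      ((coordCLM p (Sum.inl a)).hasFDerivAt (x := z))
    exact this
  refine ((h.const_mul (-(Real.pi : ℂ))).cexp).congr_fderiv ?_
  rw [smul_smul, mul_comm]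
  rfl

lemma fderiv_polyGaussian (p : ℕ) (Q : MvPolynomial (Fin p ⊕ Fin p) ℂ) (z v : Fin p → ℂ) :
    fderiv ℝ (polyGaussian p Q) z v =
      ((∑ a, (MvPolynomial.eval (fun i => coordCLM p i z) (MvPolynomial.pderiv (Sum.inl a) Q) * v a
        + MvPolynomial.eval (fun i => coordCLM p i z) (MvPolynomial.pderiv (Sum.inr a) Q)
          * (starRingEnd ℂ) (v a)))
      - Real.pi * MvPolynomial.eval (fun i => coordCLM p i z) Q *
        ∑ a, ((starRingEnd ℂ) (z a) * v a + z a * (starRingEnd ℂ) (v a))) * gaussian p z := by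
  have h : HasFDerivAt (polyGaussian p Q) _ z :=
    (hasFDerivAt_eval_clm (coordCLM p) Q z).mul (hasFDerivAt_gaussian p z)
  rw [h.fderiv]
  simp [Finset.sum_add_distrib]
  ring

lemma sum_coeff_mul_single {p : ℕ} (f g : Fin p → ℂ) (α : Fin p) (c : ℂ) :
    ∑ a, (f a * (Pi.single α c : Fin p → ℂ) a
        + g a * (starRingEnd ℂ) ((Pi.single α c : Fin p → ℂ) a))
      = f α * c + g α * (starRingEnd ℂ) c := by
  rw [Finset.sum_eq_single α]
  · simp
  · intro b _ hb
    simp [hb]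
  · simp

/-- The action of `𝒟_α` on the polynomial factor of `Q φ₀`. -/
def polyD (p : ℕ) (α : Fin p) (Q : MvPolynomial (Fin p ⊕ Fin p) ℂ) :
    MvPolynomial (Fin p ⊕ Fin p) ℂ :=
  MvPolynomial.C 2 * (Q * MvPolynomial.X (Sum.inr α))
    + MvPolynomial.C (-1 / (Real.pi : ℂ)) * MvPolynomial.pderiv (Sum.inl α) Q

/-- The action of `𝒟̄_α` on the polynomial factor of `Q φ₀`. -/
def polyDBar (p : ℕ) (α : Fin p) (Q : MvPolynomial (Fin p ⊕ Fin p) ℂ) :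
    MvPolynomial (Fin p ⊕ Fin p) ℂ :=
  MvPolynomial.C 2 * (Q * MvPolynomial.X (Sum.inl α))
    + MvPolynomial.C (-1 / (Real.pi : ℂ)) * MvPolynomial.pderiv (Sum.inr α) Q

lemma Dop_polyGaussian (p : ℕ) (α : Fin p) (Q : MvPolynomial (Fin p ⊕ Fin p) ℂ) :
    Dop p α (polyGaussian p Q) = polyGaussian p (polyD p α Q) := by
  funext z
  have hpi : (Real.pi : ℂ) ≠ 0 := by exact_mod_cast Real.pi_ne_zero
  simp only [Dop, wderiv, fderiv_polyGaussian, sum_coeff_mul_single]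
  simp only [polyGaussian, polyD, map_add, map_mul, MvPolynomial.eval_C, MvPolynomial.eval_X,
    coordCLM_inr, map_one, Complex.conj_I]
  field_simp
  ring_nf
  simp only [Complex.I_sq]
  ring

lemma DopBar_polyGaussian (p : ℕ) (α : Fin p) (Q : MvPolynomial (Fin p ⊕ Fin p) ℂ) :
    DopBar p α (polyGaussian p Q) = polyGaussian p (polyDBar p α Q) := by
  funext z
  have hpi : (Real.pi : ℂ) ≠ 0 := by exact_mod_cast Real.pi_ne_zero
  simp only [DopBar, wderivBar, fderiv_polyGaussian, sum_coeff_mul_single]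
  simp only [polyGaussian, polyDBar, map_add, map_mul, MvPolynomial.eval_C, MvPolynomial.eval_X,
    coordCLM_inl, map_one, Complex.conj_I]
  field_simp
  ring_nf
  simp only [Complex.I_sq]
  ring

lemma foldr_map_polyGaussian {p : ℕ} {op : Fin p → ((Fin p → ℂ) → ℂ) → ((Fin p → ℂ) → ℂ)}
    {T : Fin p → MvPolynomial (Fin p ⊕ Fin p) ℂ → MvPolynomial (Fin p ⊕ Fin p) ℂ}
    (h : ∀ α Q, op α (polyGaussian p Q) = polyGaussian p (T α Q))
    (L : List (Fin p)) (Q : MvPolynomial (Fin p ⊕ Fin p) ℂ) :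
    List.foldr (fun op g => op g) (polyGaussian p Q) (L.map op)
      = polyGaussian p (L.foldr T Q) := by
  induction L with
  | nil => rfl
  | cons a L ih => simp only [List.map_cons, List.foldr_cons, ih, h]

/-- The exponent of the monomial `∏_{a ∈ L} z_a`. -/
def listExponent {p : ℕ} (L : List (Fin p)) : (Fin p ⊕ Fin p) →₀ ℕ :=
  (L.map fun a => Finsupp.single (Sum.inl a) 1).sum

lemma listExponent_cons {p : ℕ} (a : Fin p) (L : List (Fin p)) :
    listExponent (a :: L) = Finsupp.single (Sum.inl a) 1 + listExponent L := by
  simp [listExponent]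

lemma listExponent_inl {p : ℕ} (L : List (Fin p)) (a : Fin p) :
    listExponent L (Sum.inl a) = L.count a := by
  induction L with
  | nil => simp [listExponent]
  | cons b L ih =>
    rw [listExponent_cons, Finsupp.add_apply, ih, List.count_cons, Finsupp.single_apply]
    simp [add_comm]

lemma listExponent_inr {p : ℕ} (L : List (Fin p)) (a : Fin p) :
    listExponent L (Sum.inr a) = 0 := by
  induction L with
  | nil => simp [listExponent]
  | cons b L ih => simp [listExponent_cons, ih]

lemma listExponent_eq_iff {p : ℕ} (L M : List (Fin p)) :
    listExponent L = listExponent M ↔ ∀ a, L.count a = M.count a := by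
  simp [Finsupp.ext_iff, listExponent_inl, listExponent_inr]

lemma foldr_polyDBar_one {p : ℕ} (L : List (Fin p)) :
    L.foldr (polyDBar p) 1 = MvPolynomial.monomial (listExponent L) ((2 : ℂ) ^ L.length) := by
  induction L with
  | nil => simp [listExponent]
  | cons a L ih =>
    rw [List.foldr_cons, ih, polyDBar, MvPolynomial.pderiv_monomial, listExponent_inr,
      listExponent_cons, MvPolynomial.X, MvPolynomial.monomial_mul, MvPolynomial.C_mul_monomial]
    simp [pow_succ', add_comm]

lemma coeff_polyD {p : ℕ} (a : Fin p) (Q : MvPolynomial (Fin p ⊕ Fin p) ℂ)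
    (t : (Fin p ⊕ Fin p) →₀ ℕ) (ht : ∀ b, t (Sum.inr b) = 0) :
    (polyD p a Q).coeff t = -1 / (Real.pi : ℂ) * (t (Sum.inl a) + 1)
      * Q.coeff (t + Finsupp.single (Sum.inl a) 1) := by
  rw [polyD, MvPolynomial.coeff_add, MvPolynomial.coeff_C_mul, MvPolynomial.coeff_C_mul,
    MvPolynomial.coeff_mul_X', MvPolynomial.coeff_pderiv]
  simp [ht]
  ring

lemma coeff_foldr_polyD {p : ℕ} (L : List (Fin p)) (Q : MvPolynomial (Fin p ⊕ Fin p) ℂ)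
    (t : (Fin p ⊕ Fin p) →₀ ℕ) (ht : ∀ b, t (Sum.inr b) = 0) :
    (L.foldr (polyD p) Q).coeff t * ∏ a, ((t (Sum.inl a)).factorial : ℂ)
      = (-1 / (Real.pi : ℂ)) ^ L.length * Q.coeff (t + listExponent L)
        * ∏ a, (((t + listExponent L) (Sum.inl a)).factorial : ℂ) := by
  induction L generalizing t with
  | nil => simp [listExponent]
  | cons b L ih =>
    have hprod : ∏ a, (((t + Finsupp.single (Sum.inl b) 1 : (Fin p ⊕ Fin p) →₀ ℕ) (Sum.inl a)).factorial : ℂ)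
        = (t (Sum.inl b) + 1) * ∏ a, ((t (Sum.inl a)).factorial : ℂ) := by
      rw [← Finset.mul_prod_erase _ _ (Finset.mem_univ b),
        ← Finset.mul_prod_erase _ (fun a => ((t (Sum.inl a)).factorial : ℂ)) (Finset.mem_univ b),
        ← mul_assoc]
      congr 1
      · simp [Nat.factorial_succ]
      · refine Finset.prod_congr rfl fun a ha => ?_
        simp [(Finset.ne_of_mem_erase ha).symm]
    have key := ih (t + Finsupp.single (Sum.inl b) 1) (by simp [ht])
    rw [hprod, add_assoc, ← listExponent_cons] at key
    rw [List.foldr_cons, coeff_polyD _ _ _ ht, List.length_cons, pow_succ']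
    linear_combination (-1 / (Real.pi : ℂ)) * key

lemma count_ofFn {n p : ℕ} (f : Fin n → Fin p) (a : Fin p) :
    (List.ofFn f).count a = (Finset.univ.filter (fun l => f l = a)).card := by
  rw [List.ofFn_eq_map, List.count, List.countP_map, List.countP_eq_length_filter]
  rw [← List.toFinset_card_of_nodup ((List.nodup_finRange n).filter _)]
  congr 1
  ext l
  simp

/-- The constant term of the polynomial `P` with
`𝒟_{α_1}⋯𝒟_{α_{q−1}} 𝒟̄_{β_1}⋯𝒟̄_{β_{q−1}} φ₀ = P(z,z̄)·φ₀` is nonzero iff every index occurs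
with the same multiplicity in `α⃗` and `β⃗`, in which case it equals
`2^{q−1} (−1/π)^{q−1} ∏_α m(α)!`.  Here `Sum.inl a` stands for `z_a`, `Sum.inr a` for `z̄_a`. -/
theorem statement5 (p q : ℕ) (hq : 1 ≤ q) (av bv : Fin (q-1) → Fin p)
    (P : MvPolynomial (Fin p ⊕ Fin p) ℂ)
    (hP : List.foldr (fun op g => op g) (gaussian p)
          (List.ofFn (fun l => Dop p (av l)) ++ List.ofFn (fun l => DopBar p (bv l)))
        = fun z => MvPolynomial.eval (Sum.elim z (fun a => (starRingEnd ℂ) (z a))) P *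
            gaussian p z) :
    (MvPolynomial.coeff 0 P ≠ 0 ↔
      ∀ a : Fin p, (Finset.univ.filter (fun l => av l = a)).card
          = (Finset.univ.filter (fun l => bv l = a)).card) ∧
    ((∀ a : Fin p, (Finset.univ.filter (fun l => av l = a)).card
          = (Finset.univ.filter (fun l => bv l = a)).card) →
      MvPolynomial.coeff 0 P
        = (2:ℂ)^(q-1) * (-1/(Real.pi : ℂ))^(q-1) *
            ∏ a : Fin p, (((Finset.univ.filter (fun l => av l = a)).card).factorial : ℂ)) := by
  have hgauss : gaussian p = polyGaussian p 1 := by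
    funext z
    simp [polyGaussian]
  have hcoeff : MvPolynomial.coeff 0 P
      = MvPolynomial.coeff 0 ((List.ofFn av).foldr (polyD p)
          ((List.ofFn bv).foldr (polyDBar p) 1)) := by
    have hav : List.ofFn (fun l => Dop p (av l)) = (List.ofFn av).map (Dop p) := by
      simp [List.map_ofFn, Function.comp_def]
    have hbv : List.ofFn (fun l => DopBar p (bv l)) = (List.ofFn bv).map (DopBar p) := by
      simp [List.map_ofFn, Function.comp_def]
    rw [List.foldr_append, hav, hbv, hgauss, foldr_map_polyGaussian (DopBar_polyGaussian p),
      foldr_map_polyGaussian (Dop_polyGaussian p)] at hP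
    have h0 := congrFun hP 0
    have hpt : (Sum.elim (0 : Fin p → ℂ) fun a => (starRingEnd ℂ) ((0 : Fin p → ℂ) a)) = 0 := by
      ext (a | a) <;> simp
    have hne : gaussian p 0 ≠ 0 := Complex.exp_ne_zero _
    simp only [hpt, ← hgauss] at h0
    simpa [polyGaussian, hne, ← MvPolynomial.constantCoeff_eq, ← Pi.zero_def, eq_comm] using h0
  have hval := coeff_foldr_polyD (List.ofFn av) ((List.ofFn bv).foldr (polyDBar p) 1) 0 (by simp)
  rw [← hcoeff, foldr_polyDBar_one, zero_add, MvPolynomial.coeff_monomial] at hval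
  simp only [listExponent_eq_iff, listExponent_inl, count_ofFn, List.length_ofFn,
    Finsupp.coe_zero, Pi.zero_apply, Nat.factorial_zero, Nat.cast_one, Finset.prod_const_one,
    mul_one] at hval
  have hpi : (Real.pi : ℂ) ≠ 0 := by exact_mod_cast Real.pi_ne_zero
  have hfac : ∏ a : Fin p,
      (((Finset.univ.filter (fun l => av l = a)).card).factorial : ℂ) ≠ 0 :=
    Finset.prod_ne_zero_iff.mpr fun a _ => by exact_mod_cast Nat.factorial_ne_zero _
  rw [hval]
  constructor
  · constructor
    · intro h a
      by_contra hne
      exact h (by rw [if_neg fun hall => hne (hall a).symm]; simp)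
    · intro h
      rw [if_pos fun a => (h a).symm]
      exact mul_ne_zero (mul_ne_zero (pow_ne_zero _ (div_ne_zero (by norm_num) hpi))
        (pow_ne_zero _ two_ne_zero)) hfac
  · intro h
    rw [if_pos fun a => (h a).symm]
    ring
end
end

section
/- With the operators L, ∂ and ∂̄ on R ⊗ Λ defined below, one has the identity L φ' = (−1)^{q−1} · 4π · ∂ ∂̄ ψ'. (This is the Fock-model form of the key relation ω(L) φ_KM = dd^c ψ between the Kudla–Millson Schwartz form and the Schwartz form ψ, where ω(L) is the Weil-representation action of the Maass lowering element.) -/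
open MvPolynomial
open scoped TensorProduct

noncomputable section

/-- Index type for the polynomial variables: `Sum.inl (Sum.inl α) = z''_α`,
`Sum.inl (Sum.inr α) = z'_α` (for `1 ≤ α ≤ p`), `Sum.inr (Sum.inl μ) = z'_{p+μ}`,
`Sum.inr (Sum.inr μ) = z''_{p+μ}` (for `1 ≤ μ ≤ q`). -/
abbrev PVar (p q : ℕ) := (Fin p ⊕ Fin p) ⊕ (Fin q ⊕ Fin q)

/-- The polynomial ring `R = ℂ[z''_α, z'_α, z'_{p+μ}, z''_{p+μ}]`. -/
abbrev RP (p q : ℕ) := MvPolynomial (PVar p q) ℂ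

/-- The variable `z''_α`, `1 ≤ α ≤ p`. -/
def zpp (p q : ℕ) (α : Fin p) : RP p q := X (Sum.inl (Sum.inl α))

/-- The variable `z'_α`, `1 ≤ α ≤ p`. -/
def zp (p q : ℕ) (α : Fin p) : RP p q := X (Sum.inl (Sum.inr α))

/-- The variable `z'_{p+μ}`, `1 ≤ μ ≤ q`. -/
def zmp (p q : ℕ) (μ : Fin q) : RP p q := X (Sum.inr (Sum.inl μ))

/-- The variable `z''_{p+μ}`, `1 ≤ μ ≤ q`. -/
def zmpp (p q : ℕ) (μ : Fin q) : RP p q := X (Sum.inr (Sum.inr μ))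

/-- The generating module of the exterior algebra, with basis indexed by
`(false, α, μ) ↦ ξ'_{α,p+μ}` and `(true, α, μ) ↦ ξ''_{α,p+μ}`. -/
abbrev LamV (p q : ℕ) := (Bool × Fin p × Fin q) → ℂ

/-- The exterior algebra `Λ` on the generators `ξ'_{αμ}, ξ''_{αμ}`. -/
abbrev Lam (p q : ℕ) := ExteriorAlgebra ℂ (LamV p q)

/-- The generator `ξ'_{α,p+μ}` (for `b = false`) resp. `ξ''_{α,p+μ}` (for `b = true`). -/
def xi (p q : ℕ) (b : Bool) (α : Fin p) (μ : Fin q) : Lam p q :=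
  ExteriorAlgebra.ι ℂ (Pi.single (b, α, μ) (1 : ℂ))

/-- For `j : Fin q` and `l : Fin (q-1)`, the `l`-th member of the increasing list of
elements of `{p+1, …, p+q} \ {p+j}` (in `Fin q` coordinates). -/
def muIdx (q : ℕ) (j : Fin q) (l : Fin (q-1)) : Fin q :=
  if (l : ℕ) < (j : ℕ) then ⟨l, by have := l.isLt; omega⟩
  else ⟨(l : ℕ) + 1, by have := l.isLt; omega⟩

/-- `Ω_{q−1}(α⃗;β⃗) = Σ_{j=1}^q ξ'_{α_1,μ_1} ∧ ⋯ ∧ ξ'_{α_{q−1},μ_{q−1}}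
∧ ξ''_{β_1,μ_1} ∧ ⋯ ∧ ξ''_{β_{q−1},μ_{q−1}}` where `(μ_1,…,μ_{q−1})` is the increasing list
of elements of `{p+1,…,p+q} \ {p+j}`. -/
def OmegaSub (p q : ℕ) (a b : Fin (q-1) → Fin p) : Lam p q :=
  ∑ j : Fin q,
    (List.ofFn fun l : Fin (q-1) => xi p q false (a l) (muIdx q j l)).prod *
    (List.ofFn fun l : Fin (q-1) => xi p q true (b l) (muIdx q j l)).prod

/-- `Ω_q(α⃗;β⃗) = ξ'_{α_1,p+1} ∧ ⋯ ∧ ξ'_{α_q,p+q} ∧ ξ''_{β_1,p+1} ∧ ⋯ ∧ ξ''_{β_q,p+q}`. -/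
def OmegaTop (p q : ℕ) (a b : Fin q → Fin p) : Lam p q :=
  (List.ofFn fun j : Fin q => xi p q false (a j) j).prod *
  (List.ofFn fun j : Fin q => xi p q true (b j) j).prod

/-- `φ' = Σ_{α⃗,β⃗ ∈ {1,…,p}^q} z''_{α_1}⋯z''_{α_q} z'_{β_1}⋯z'_{β_q} ⊗ Ω_q(α⃗;β⃗)`. -/
def phiF (p q : ℕ) : RP p q ⊗[ℂ] Lam p q :=
  ∑ a : Fin q → Fin p, ∑ b : Fin q → Fin p,
    ((∏ j, zpp p q (a j)) * (∏ j, zp p q (b j))) ⊗ₜ[ℂ] OmegaTop p q a b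

/-- `ψ' = Σ_{α⃗,β⃗ ∈ {1,…,p}^{q−1}} z''_{α_1}⋯z''_{α_{q−1}} z'_{β_1}⋯z'_{β_{q−1}} ⊗ Ω_{q−1}(α⃗;β⃗)`. -/
def psiF (p q : ℕ) : RP p q ⊗[ℂ] Lam p q :=
  ∑ a : Fin (q-1) → Fin p, ∑ b : Fin (q-1) → Fin p,
    ((∏ l, zpp p q (a l)) * (∏ l, zp p q (b l))) ⊗ₜ[ℂ] OmegaSub p q a b

/-- The Fock-model lowering operator
`L = −4π Σ_{γ=1}^{p+q} ∂²/(∂z''_γ ∂z'_γ) + (1/4π) Σ_μ z''_μ z'_μ` on the polynomial factor. -/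
def Lop (p q : ℕ) : RP p q →ₗ[ℂ] RP p q :=
  (-(4 * (Real.pi : ℂ))) •
    ((∑ α : Fin p,
        (pderiv (Sum.inl (Sum.inl α))).toLinearMap ∘ₗ (pderiv (Sum.inl (Sum.inr α))).toLinearMap)
      + (∑ μ : Fin q,
        (pderiv (Sum.inr (Sum.inr μ))).toLinearMap ∘ₗ (pderiv (Sum.inr (Sum.inl μ))).toLinearMap))
  + (1/(4 * (Real.pi : ℂ))) • LinearMap.mulLeft ℂ (∑ μ : Fin q, zmpp p q μ * zmp p q μ)

/-- `∂ = Σ_{α,μ} [ (1/4π) z''_α z'_μ − 4π ∂²/(∂z'_α ∂z''_μ) ] ⊗ A'_{αμ}`. -/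
def delOp (p q : ℕ) : RP p q ⊗[ℂ] Lam p q →ₗ[ℂ] RP p q ⊗[ℂ] Lam p q :=
  ∑ α : Fin p, ∑ μ : Fin q,
    TensorProduct.map
      ((1/(4 * (Real.pi : ℂ))) • LinearMap.mulLeft ℂ (zpp p q α * zmp p q μ)
        - (4 * (Real.pi : ℂ)) •
          ((pderiv (Sum.inl (Sum.inr α))).toLinearMap ∘ₗ
            (pderiv (Sum.inr (Sum.inr μ))).toLinearMap))
      (LinearMap.mulLeft ℂ (xi p q false α μ))

/-- `∂̄ = Σ_{β,ν} [ (1/4π) z'_β z''_ν − 4π ∂²/(∂z''_β ∂z'_ν) ] ⊗ A''_{βν}`. -/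
def delBarOp (p q : ℕ) : RP p q ⊗[ℂ] Lam p q →ₗ[ℂ] RP p q ⊗[ℂ] Lam p q :=
  ∑ β : Fin p, ∑ ν : Fin q,
    TensorProduct.map
      ((1/(4 * (Real.pi : ℂ))) • LinearMap.mulLeft ℂ (zp p q β * zmpp p q ν)
        - (4 * (Real.pi : ℂ)) •
          ((pderiv (Sum.inl (Sum.inl β))).toLinearMap ∘ₗ
            (pderiv (Sum.inr (Sum.inl ν))).toLinearMap))
      (LinearMap.mulLeft ℂ (xi p q true β ν))

section Anticommuting

variable {A : Type*} [Ring A]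

theorem mul_list_prod_of_anticomm [Algebra ℂ A] (y : A) (l : List A) (h : ∀ x ∈ l, y * x = -(x * y)) :
    y * l.prod = (-1 : ℂ) ^ l.length • (l.prod * y) := by
  induction l with
  | nil => simp
  | cons a l ih =>
    have ih' := ih fun x hx => h x (List.mem_cons_of_mem _ hx)
    rw [List.prod_cons, ← mul_assoc, h a List.mem_cons_self, neg_mul, mul_assoc, ih',
      List.length_cons, pow_succ, mul_smul_comm, mul_assoc]
    simp

theorem mul_list_prod_eq_zero_of_mem (y : A) (l : List A) (h : ∀ x ∈ l, y * x = -(x * y))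
    (hy : y * y = 0) (hmem : y ∈ l) : y * l.prod = 0 := by
  induction l with
  | nil => simp at hmem
  | cons a l ih =>
    rw [List.prod_cons, ← mul_assoc]
    rcases List.mem_cons.1 hmem with rfl | hl
    · rw [hy, zero_mul]
    · rw [h a List.mem_cons_self, neg_mul, mul_assoc,
        ih (fun x hx => h x (List.mem_cons_of_mem _ hx)) hl, mul_zero, neg_zero]

/-- Moving the `j`-th factor of an ordered product back into its place. -/
theorem mul_prod_succAbove [Algebra ℂ A] {n : ℕ} (x : Fin (n + 1) → A) (h : ∀ i j, x i * x j = -(x j * x i))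
    (j : Fin (n + 1)) :
    x j * (List.ofFn fun l => x (j.succAbove l)).prod
      = (-1 : ℂ) ^ (j : ℕ) • (List.ofFn x).prod := by
  induction n with
  | zero => rw [Fin.fin_one_eq_zero j]; simp
  | succ n ih =>
    refine Fin.cases ?_ (fun j => ?_) j
    · simp
    · have ih' := ih (fun i => x i.succ) (fun i k => h _ _) j
      rw [List.ofFn_succ, List.prod_cons, List.ofFn_succ (f := x), List.prod_cons, ← mul_assoc,
        Fin.succ_succAbove_zero, h, neg_mul, mul_assoc]
      simp only [Fin.succ_succAbove_succ]
      rw [ih', Fin.val_succ, pow_succ]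
      simp

/-- The Leibniz rule for an ordered product, with the differentiated factor moved to the front. -/
theorem leibniz_prod_ofFn [Algebra ℂ A] (d : A →ₗ[ℂ] A) (hd : ∀ a b, d (a * b) = d a * b + a * d b) {n : ℕ}
    (x : Fin (n + 1) → A) (h : ∀ i j, x i * d (x j) = -(d (x j) * x i)) :
    d (List.ofFn x).prod
      = ∑ j : Fin (n + 1), (-1 : ℂ) ^ (j : ℕ) • (d (x j) * (List.ofFn fun l => x (j.succAbove l)).prod) := by
  have hone : d 1 = 0 := by simpa using hd 1 1
  induction n with
  | zero => simp
  | succ n ih =>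
    have ih' := ih (fun i => x i.succ) (fun i k => h _ _)
    rw [List.ofFn_succ, List.prod_cons, hd, ih', Fin.sum_univ_succ (n := n + 1), Finset.mul_sum]
    congr 1
    · simp
    · refine Finset.sum_congr rfl fun j _ => ?_
      rw [List.ofFn_succ (f := fun l => x (j.succ.succAbove l)), List.prod_cons,
        Fin.succ_succAbove_zero, mul_smul_comm, ← mul_assoc, h, Fin.val_succ, pow_succ]
      simp [mul_assoc]

theorem leibniz_list_prod_eq_zero [Algebra ℂ A] (d : A →ₗ[ℂ] A) (hd : ∀ a b, d (a * b) = d a * b + a * d b)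
    (l : List A) (h : ∀ x ∈ l, d x = 0) : d l.prod = 0 := by
  induction l with
  | nil => simpa using hd 1 1
  | cons a l ih =>
    rw [List.prod_cons, hd, h a List.mem_cons_self,
      ih fun x hx => h x (List.mem_cons_of_mem _ hx)]
    simp

theorem prod_ofFn_sum {ι : Type*} [Fintype ι] {n : ℕ} (g : Fin n → ι → A) :
    (List.ofFn fun j => ∑ i, g j i).prod
      = ∑ a : Fin n → ι, (List.ofFn fun j => g j (a j)).prod := by
  induction n with
  | zero => simp
  | succ n ih =>
    rw [List.ofFn_succ, List.prod_cons, ih, Finset.sum_mul_sum,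
      ← (Fin.consEquiv fun _ => ι).sum_comp, Fintype.sum_prod_type]
    simp [List.ofFn_succ, Fin.consEquiv]

end Anticommuting

section Tensor

variable {S Λ : Type*} [CommRing S] [Algebra ℂ S] [Ring Λ] [Algebra ℂ Λ]

theorem prod_ofFn_tmul {n : ℕ} (z : Fin n → S) (x : Fin n → Λ) :
    (List.ofFn fun j => z j ⊗ₜ[ℂ] x j).prod = (∏ j, z j) ⊗ₜ[ℂ] (List.ofFn x).prod := by
  induction n with
  | zero => simp [Algebra.TensorProduct.one_def]
  | succ n ih => simp [List.ofFn_succ, ih, Fin.prod_univ_succ]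

theorem tmul_one_mul_comm (r : S) (w : S ⊗[ℂ] Λ) : (r ⊗ₜ[ℂ] (1 : Λ)) * w = w * r ⊗ₜ[ℂ] 1 := by
  induction w with
  | zero => simp
  | tmul a b => simp [mul_comm]
  | add a b ha hb => rw [mul_add, add_mul, ha, hb]

theorem rTensor_derivation_mul (d : Derivation ℂ S S) (a b : S ⊗[ℂ] Λ) :
    LinearMap.rTensor Λ d.toLinearMap (a * b)
      = LinearMap.rTensor Λ d.toLinearMap a * b + a * LinearMap.rTensor Λ d.toLinearMap b := by
  induction a with
  | zero => simp
  | add a a' ha ha' => rw [add_mul, map_add, map_add, ha, ha', add_mul, add_mul]; abel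
  | tmul r x =>
    induction b with
    | zero => simp
    | add b b' hb hb' => rw [mul_add, map_add, map_add, hb, hb', mul_add, mul_add]; abel
    | tmul s y =>
      simp only [Algebra.TensorProduct.tmul_mul_tmul, LinearMap.rTensor_tmul,
        Derivation.coeFn_coe, Derivation.leibniz, smul_eq_mul,
        TensorProduct.add_tmul]
      rw [add_comm, mul_comm s]

theorem map_mulLeft_sub_comp (c c' : ℂ) (r : S) (d d' : Derivation ℂ S S) (x : Λ)
    (w : S ⊗[ℂ] Λ) :
    TensorProduct.map (c • LinearMap.mulLeft ℂ r - c' • (d.toLinearMap ∘ₗ d'.toLinearMap))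
        (LinearMap.mulLeft ℂ x) w
      = c • ((r ⊗ₜ x) * w) - c' • (((1 : S) ⊗ₜ x) *
          LinearMap.rTensor Λ d.toLinearMap (LinearMap.rTensor Λ d'.toLinearMap w)) := by
  induction w with
  | zero => simp
  | add a b ha hb => simp only [map_add, mul_add, ha, hb, smul_add]; abel
  | tmul a b => simp [TensorProduct.sub_tmul, TensorProduct.smul_tmul']

theorem tmul_ι_mul_tmul_ι {V : Type*} [AddCommGroup V] [Module ℂ V] (r s : S) (v w : V) :
    (r ⊗ₜ[ℂ] ExteriorAlgebra.ι ℂ v) * (s ⊗ₜ[ℂ] ExteriorAlgebra.ι ℂ w)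
      = -((s ⊗ₜ[ℂ] ExteriorAlgebra.ι ℂ w) * (r ⊗ₜ[ℂ] ExteriorAlgebra.ι ℂ v)) := by
  rw [Algebra.TensorProduct.tmul_mul_tmul, Algebra.TensorProduct.tmul_mul_tmul, mul_comm s,
    ← TensorProduct.tmul_neg, eq_neg_of_add_eq_zero_left (ExteriorAlgebra.ι_add_mul_swap v w)]

end Tensor

section Fock

variable {p q : ℕ}

/-- The odd element `Σ_α z''_α ⊗ ξ'_{αμ}`. -/
def oddPrime (p q : ℕ) (μ : Fin q) : RP p q ⊗[ℂ] Lam p q :=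
  ∑ α : Fin p, zpp p q α ⊗ₜ[ℂ] xi p q false α μ

/-- The odd element `Σ_β z'_β ⊗ ξ''_{βμ}`. -/
def oddDoublePrime (p q : ℕ) (μ : Fin q) : RP p q ⊗[ℂ] Lam p q :=
  ∑ β : Fin p, zp p q β ⊗ₜ[ℂ] xi p q true β μ

/-- The partial derivative in the variable `i`, acting on the polynomial factor. -/
def partialOp (p q : ℕ) (i : PVar p q) : RP p q ⊗[ℂ] Lam p q →ₗ[ℂ] RP p q ⊗[ℂ] Lam p q :=
  LinearMap.rTensor (Lam p q) (pderiv i).toLinearMap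

theorem partialOp_mul (i : PVar p q) (a b : RP p q ⊗[ℂ] Lam p q) :
    partialOp p q i (a * b) = partialOp p q i a * b + a * partialOp p q i b :=
  rTensor_derivation_mul _ a b

theorem partialOp_tmul (i : PVar p q) (r : RP p q) (x : Lam p q) :
    partialOp p q i (r ⊗ₜ x) = pderiv i r ⊗ₜ x := rfl

theorem tmul_xi_anticomm (r s : RP p q) (b c : Bool) (α β : Fin p) (μ ν : Fin q) :
    (r ⊗ₜ[ℂ] xi p q b α μ) * (s ⊗ₜ[ℂ] xi p q c β ν)
      = -((s ⊗ₜ[ℂ] xi p q c β ν) * (r ⊗ₜ[ℂ] xi p q b α μ)) :=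
  tmul_ι_mul_tmul_ι _ _ _ _

theorem sum_mul_sum_anticomm {A ι κ : Type*} [Ring A] [Fintype ι] [Fintype κ]
    (f : ι → A) (g : κ → A) (h : ∀ i k, f i * g k = -(g k * f i)) :
    (∑ i, f i) * ∑ k, g k = -((∑ k, g k) * ∑ i, f i) := by
  rw [Finset.sum_mul_sum, Finset.sum_mul_sum, Finset.sum_comm]
  simp only [h, Finset.sum_neg_distrib]

theorem oddPrime_anticomm (μ ν : Fin q) :
    oddPrime p q μ * oddPrime p q ν = -(oddPrime p q ν * oddPrime p q μ) :=
  sum_mul_sum_anticomm _ _ fun _ _ => tmul_xi_anticomm _ _ _ _ _ _ _ _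

theorem oddDoublePrime_anticomm (μ ν : Fin q) :
    oddDoublePrime p q μ * oddDoublePrime p q ν
      = -(oddDoublePrime p q ν * oddDoublePrime p q μ) :=
  sum_mul_sum_anticomm _ _ fun _ _ => tmul_xi_anticomm _ _ _ _ _ _ _ _

theorem oddDoublePrime_oddPrime_anticomm (μ ν : Fin q) :
    oddDoublePrime p q μ * oddPrime p q ν = -(oddPrime p q ν * oddDoublePrime p q μ) :=
  sum_mul_sum_anticomm _ _ fun _ _ => tmul_xi_anticomm _ _ _ _ _ _ _ _

theorem oddPrime_mul_tmul_xi (μ ν : Fin q) (r : RP p q) (b : Bool) (α : Fin p) :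
    oddPrime p q μ * (r ⊗ₜ xi p q b α ν) = -((r ⊗ₜ xi p q b α ν) * oddPrime p q μ) := by
  simpa [oddPrime] using sum_mul_sum_anticomm (κ := Unit) (fun α => zpp p q α ⊗ₜ[ℂ] xi p q false α μ)
    (fun _ => r ⊗ₜ xi p q b α ν) fun _ _ => tmul_xi_anticomm _ _ _ _ _ _ _ _

theorem neg_smul_add_eq_sub {M : Type*} [AddCommGroup M] [Module ℂ M] (c : ℂ) (x y : M) :
    -c • x + y = y - c • x := by
  rw [neg_smul, neg_add_eq_sub]

theorem mul_self_eq_zero_of_anticomm {A : Type*} [Ring A] [Algebra ℂ A] {x : A}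
    (h : x * x = -(x * x)) : x * x = 0 := by
  have h2 : (2 : ℂ) • (x * x) = 0 := by
    rw [two_smul]
    nth_rewrite 1 [h]
    exact neg_add_cancel _
  exact (smul_eq_zero_iff_right two_ne_zero).1 h2

theorem partialOp_oddPrime (α : Fin p) (μ : Fin q) :
    partialOp p q (Sum.inl (Sum.inl α)) (oddPrime p q μ) = 1 ⊗ₜ xi p q false α μ := by
  simp [oddPrime, partialOp_tmul, zpp, pderiv_X, Pi.single_apply, TensorProduct.ite_tmul]

theorem partialOp_oddPrime_of_ne (i : PVar p q) (h : ∀ α, i ≠ Sum.inl (Sum.inl α)) (μ : Fin q) :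
    partialOp p q i (oddPrime p q μ) = 0 := by
  simp only [oddPrime, map_sum, partialOp_tmul, zpp, pderiv_X_of_ne (h _).symm,
    TensorProduct.zero_tmul, Finset.sum_const_zero]

theorem partialOp_oddDoublePrime_of_ne (i : PVar p q) (h : ∀ α, i ≠ Sum.inl (Sum.inr α))
    (μ : Fin q) : partialOp p q i (oddDoublePrime p q μ) = 0 := by
  simp only [oddDoublePrime, map_sum, partialOp_tmul, zp, pderiv_X_of_ne (h _).symm,
    TensorProduct.zero_tmul, Finset.sum_const_zero]

theorem partialOp_prod_oddPrime (i : PVar p q) (h : ∀ α, i ≠ Sum.inl (Sum.inl α)) {m : ℕ}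
    (f : Fin m → Fin q) :
    partialOp p q i (List.ofFn fun l => oddPrime p q (f l)).prod = 0 := by
  refine leibniz_list_prod_eq_zero _ (partialOp_mul i) _ fun x hx => ?_
  obtain ⟨l, rfl⟩ := (List.mem_ofFn' _ _).1 hx
  exact partialOp_oddPrime_of_ne i h _

theorem partialOp_prod_oddDoublePrime (i : PVar p q) (h : ∀ α, i ≠ Sum.inl (Sum.inr α)) {m : ℕ}
    (f : Fin m → Fin q) :
    partialOp p q i (List.ofFn fun l => oddDoublePrime p q (f l)).prod = 0 := by
  refine leibniz_list_prod_eq_zero _ (partialOp_mul i) _ fun x hx => ?_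
  obtain ⟨l, rfl⟩ := (List.mem_ofFn' _ _).1 hx
  exact partialOp_oddDoublePrime_of_ne i h _

theorem pderiv_pderiv_comm {σ S : Type*} [CommRing S] (i k : σ) (f : MvPolynomial σ S) :
    pderiv i (pderiv k f) = pderiv k (pderiv i f) := by
  classical
  have h : ⁅pderiv (R := S) i, pderiv (R := S) k⁆ = 0 :=
    derivation_ext fun m => by
      simp [Derivation.commutator_apply, pderiv_X, Pi.single_apply, apply_ite]
  exact sub_eq_zero.1 (DFunLike.congr_fun h f)

theorem partialOp_comm (i k : PVar p q) (w : RP p q ⊗[ℂ] Lam p q) :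
    partialOp p q i (partialOp p q k w) = partialOp p q k (partialOp p q i w) := by
  induction w with
  | zero => simp
  | add a b ha hb => simp only [map_add, ha, hb]
  | tmul a b => simp only [partialOp_tmul, pderiv_pderiv_comm i k]

theorem sum_tmul_prod_xi {m : ℕ} (b : Bool) (z : Fin p → RP p q) (f : Fin m → Fin q) :
    ∑ a : Fin m → Fin p, (∏ j, z (a j)) ⊗ₜ[ℂ] (List.ofFn fun j => xi p q b (a j) (f j)).prod
      = (List.ofFn fun j => ∑ α, z α ⊗ₜ[ℂ] xi p q b α (f j)).prod := by
  rw [prod_ofFn_sum]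
  simp only [prod_ofFn_tmul]

theorem phiF_eq : phiF p q
    = (List.ofFn (oddPrime p q)).prod * (List.ofFn (oddDoublePrime p q)).prod := by
  have h1 := sum_tmul_prod_xi (p := p) false (zpp p q) (fun j : Fin q => j)
  have h2 := sum_tmul_prod_xi (p := p) true (zp p q) (fun j : Fin q => j)
  change _ = (List.ofFn (oddPrime p q)).prod at h1
  change _ = (List.ofFn (oddDoublePrime p q)).prod at h2
  rw [← h1, ← h2, Finset.sum_mul_sum]
  simp only [phiF, OmegaTop, Algebra.TensorProduct.tmul_mul_tmul]

theorem muIdx_eq_succAbove {n : ℕ} (j : Fin (n + 1)) (l : Fin n) :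
    muIdx (n + 1) j l = j.succAbove l := by
  simp only [muIdx, Fin.succAbove, Fin.lt_def, Fin.val_castSucc]
  rfl

/-- The ordered product of all `oddPrime` elements but the `j`-th. -/
def prodPrimeOmit (p : ℕ) {n : ℕ} (j : Fin (n + 1)) : RP p (n + 1) ⊗[ℂ] Lam p (n + 1) :=
  (List.ofFn fun l => oddPrime p (n + 1) (j.succAbove l)).prod

/-- The ordered product of all `oddDoublePrime` elements but the `j`-th. -/
def prodDoublePrimeOmit (p : ℕ) {n : ℕ} (j : Fin (n + 1)) : RP p (n + 1) ⊗[ℂ] Lam p (n + 1) :=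
  (List.ofFn fun l => oddDoublePrime p (n + 1) (j.succAbove l)).prod

theorem psiF_eq {n : ℕ} :
    psiF p (n + 1) = ∑ j : Fin (n + 1), prodPrimeOmit p j * prodDoublePrimeOmit p j := by
  have h1 (j : Fin (n + 1)) := sum_tmul_prod_xi (p := p) false (zpp p (n + 1)) j.succAbove
  have h2 (j : Fin (n + 1)) := sum_tmul_prod_xi (p := p) true (zp p (n + 1)) j.succAbove
  change ∀ j, _ = prodPrimeOmit p j at h1
  change ∀ j, _ = prodDoublePrimeOmit p j at h2
  simp only [← h1, ← h2, Finset.sum_mul_sum, Algebra.TensorProduct.tmul_mul_tmul]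
  rw [Finset.sum_comm, psiF]
  refine Finset.sum_congr rfl fun a _ => ?_
  rw [Finset.sum_comm]
  refine Finset.sum_congr rfl fun b _ => ?_
  simp only [OmegaSub, TensorProduct.tmul_sum]
  simp only [← muIdx_eq_succAbove]
  rfl

theorem rTensor_Lop (w : RP p q ⊗[ℂ] Lam p q) :
    LinearMap.rTensor (Lam p q) (Lop p q) w
      = -(4 * (Real.pi : ℂ)) •
          ((∑ α, partialOp p q (Sum.inl (Sum.inl α)) (partialOp p q (Sum.inl (Sum.inr α)) w))
            + ∑ μ, partialOp p q (Sum.inr (Sum.inr μ)) (partialOp p q (Sum.inr (Sum.inl μ)) w))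
        + (1 / (4 * (Real.pi : ℂ))) • ∑ μ, ((zmpp p q μ * zmp p q μ) ⊗ₜ 1) * w := by
  induction w with
  | zero => simp
  | add a b ha hb =>
    simp only [map_add, mul_add, ha, hb, smul_add, Finset.sum_add_distrib]
    abel
  | tmul a b =>
    simp [Lop, partialOp_tmul, TensorProduct.sum_tmul, Finset.sum_mul]

theorem delBarOp_apply (w : RP p q ⊗[ℂ] Lam p q)
    (h : ∀ ν, partialOp p q (Sum.inr (Sum.inl ν)) w = 0) :
    delBarOp p q w = (1 / (4 * (Real.pi : ℂ))) •
      ∑ ν, (zmpp p q ν ⊗ₜ 1) * (oddDoublePrime p q ν * w) := by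
  have hz (ν : Fin q) :
      LinearMap.rTensor (Lam p q) (pderiv (R := ℂ) (Sum.inr (Sum.inl ν))).toLinearMap w = 0 := h ν
  rw [delBarOp, Finset.sum_comm]
  simp only [LinearMap.sum_apply, map_mulLeft_sub_comp, hz, map_zero, mul_zero, smul_zero,
    sub_zero, Finset.smul_sum, oddDoublePrime, Finset.sum_mul, Finset.mul_sum, ← mul_assoc,
    Algebra.TensorProduct.tmul_mul_tmul, one_mul]
  simp only [mul_comm]

theorem delOp_apply (w : RP p q ⊗[ℂ] Lam p q) :
    delOp p q w = (1 / (4 * (Real.pi : ℂ))) • (∑ μ, (zmp p q μ ⊗ₜ 1) * (oddPrime p q μ * w))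
      - (4 * (Real.pi : ℂ)) • ∑ α, ∑ μ, (1 ⊗ₜ xi p q false α μ) *
          partialOp p q (Sum.inl (Sum.inr α)) (partialOp p q (Sum.inr (Sum.inr μ)) w) := by
  rw [delOp]
  simp only [LinearMap.sum_apply, map_mulLeft_sub_comp, Finset.sum_sub_distrib]
  congr 1
  · rw [Finset.sum_comm]
    simp only [Finset.smul_sum, oddPrime, Finset.sum_mul, Finset.mul_sum, ← mul_assoc,
      Algebra.TensorProduct.tmul_mul_tmul, one_mul]
    simp only [mul_comm]
  · simp only [Finset.smul_sum]
    rfl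

theorem oddPrime_mul_prodPrimeOmit {n : ℕ} (μ j : Fin (n + 1)) :
    oddPrime p (n + 1) μ * prodPrimeOmit p j
      = if μ = j then (-1 : ℂ) ^ (j : ℕ) • (List.ofFn (oddPrime p (n + 1))).prod else 0 := by
  split_ifs with h
  · subst h
    exact mul_prod_succAbove _ oddPrime_anticomm μ
  · refine mul_list_prod_eq_zero_of_mem _ _ (fun x hx => ?_)
      (mul_self_eq_zero_of_anticomm (oddPrime_anticomm μ μ)) ?_
    · obtain ⟨l, rfl⟩ := (List.mem_ofFn' _ _).1 hx
      exact oddPrime_anticomm _ _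
    · obtain ⟨l, rfl⟩ := Fin.exists_succAbove_eq h
      exact (List.mem_ofFn' _ _).2 ⟨l, rfl⟩

theorem oddDoublePrime_mul_prodDoublePrimeOmit {n : ℕ} (μ j : Fin (n + 1)) :
    oddDoublePrime p (n + 1) μ * prodDoublePrimeOmit p j
      = if μ = j then (-1 : ℂ) ^ (j : ℕ) • (List.ofFn (oddDoublePrime p (n + 1))).prod
        else 0 := by
  split_ifs with h
  · subst h
    exact mul_prod_succAbove _ oddDoublePrime_anticomm μ
  · refine mul_list_prod_eq_zero_of_mem _ _ (fun x hx => ?_)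
      (mul_self_eq_zero_of_anticomm (oddDoublePrime_anticomm μ μ)) ?_
    · obtain ⟨l, rfl⟩ := (List.mem_ofFn' _ _).1 hx
      exact oddDoublePrime_anticomm _ _
    · obtain ⟨l, rfl⟩ := Fin.exists_succAbove_eq h
      exact (List.mem_ofFn' _ _).2 ⟨l, rfl⟩

theorem oddDoublePrime_mul_prodPrimeOmit {n : ℕ} (ν j : Fin (n + 1)) :
    oddDoublePrime p (n + 1) ν * prodPrimeOmit p j
      = (-1 : ℂ) ^ n • (prodPrimeOmit p j * oddDoublePrime p (n + 1) ν) := by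
  have h := mul_list_prod_of_anticomm (oddDoublePrime p (n + 1) ν)
    (List.ofFn fun l => oddPrime p (n + 1) (j.succAbove l)) fun x hx => by
      obtain ⟨l, rfl⟩ := (List.mem_ofFn' _ _).1 hx
      exact oddDoublePrime_oddPrime_anticomm _ _
  rwa [List.length_ofFn] at h

theorem partialOp_prod_oddPrime_eq_sum {n : ℕ} (α : Fin p) :
    partialOp p (n + 1) (Sum.inl (Sum.inl α)) (List.ofFn (oddPrime p (n + 1))).prod
      = ∑ j : Fin (n + 1), (-1 : ℂ) ^ (j : ℕ) •
          ((1 ⊗ₜ xi p (n + 1) false α j) * prodPrimeOmit p j) := by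
  rw [leibniz_prod_ofFn _ (partialOp_mul _) _ fun i j => by
    rw [partialOp_oddPrime, oddPrime_mul_tmul_xi]]
  simp only [partialOp_oddPrime]
  rfl

theorem delBarOp_psiF {n : ℕ} :
    delBarOp p (n + 1) (psiF p (n + 1)) = ((-1 : ℂ) ^ n * (1 / (4 * (Real.pi : ℂ)))) •
      ∑ j : Fin (n + 1), (-1 : ℂ) ^ (j : ℕ) • ((zmpp p (n + 1) j ⊗ₜ 1) *
        (prodPrimeOmit p j * (List.ofFn (oddDoublePrime p (n + 1))).prod)) := by
  rw [psiF_eq, delBarOp_apply _ fun ν => by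
    simp [partialOp_mul, prodPrimeOmit, prodDoublePrimeOmit, partialOp_prod_oddPrime,
      partialOp_prod_oddDoublePrime]]
  have key (ν j : Fin (n + 1)) :
      oddDoublePrime p (n + 1) ν * (prodPrimeOmit p j * prodDoublePrimeOmit p j)
        = if ν = j then (-1 : ℂ) ^ n • (-1 : ℂ) ^ (j : ℕ) •
            (prodPrimeOmit p j * (List.ofFn (oddDoublePrime p (n + 1))).prod) else 0 := by
    rw [← mul_assoc, oddDoublePrime_mul_prodPrimeOmit, smul_mul_assoc, mul_assoc,
      oddDoublePrime_mul_prodDoublePrimeOmit]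
    split_ifs
    · rw [mul_smul_comm]
    · rw [mul_zero, smul_zero]
  simp only [Finset.mul_sum, key, Finset.sum_ite_eq, Finset.mem_univ, if_true,
    mul_smul_comm, ← Finset.smul_sum]
  rw [smul_smul, mul_comm]

theorem partialOp_zmpp_mul (μ ν : Fin q) (w : RP p q ⊗[ℂ] Lam p q)
    (h : ∀ ν, partialOp p q (Sum.inr (Sum.inr ν)) w = 0) :
    partialOp p q (Sum.inr (Sum.inr μ)) ((zmpp p q ν ⊗ₜ 1) * w) = if μ = ν then w else 0 := by
  rw [partialOp_mul, h, mul_zero, add_zero, partialOp_tmul, zmpp, pderiv_X]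
  by_cases hμ : μ = ν
  · subst hμ
    simp [← Algebra.TensorProduct.one_def]
  · simp [hμ, Ne.symm hμ]

theorem delOp_zmpp_mul {n : ℕ} (j : Fin (n + 1)) :
    delOp p (n + 1) ((zmpp p (n + 1) j ⊗ₜ 1) *
        (prodPrimeOmit p j * (List.ofFn (oddDoublePrime p (n + 1))).prod))
      = (1 / (4 * (Real.pi : ℂ))) • (-1 : ℂ) ^ (j : ℕ) •
          (((zmpp p (n + 1) j * zmp p (n + 1) j) ⊗ₜ 1) * phiF p (n + 1))
        - (4 * (Real.pi : ℂ)) • ∑ α, ((1 ⊗ₜ xi p (n + 1) false α j) * prodPrimeOmit p j) *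
          partialOp p (n + 1) (Sum.inl (Sum.inr α))
            (List.ofFn (oddDoublePrime p (n + 1))).prod := by
  have h (ν : Fin (n + 1)) : partialOp p (n + 1) (Sum.inr (Sum.inr ν))
      (prodPrimeOmit p j * (List.ofFn (oddDoublePrime p (n + 1))).prod) = 0 := by
    have h2 := partialOp_prod_oddDoublePrime (p := p) (q := n + 1) (Sum.inr (Sum.inr ν))
      (by simp) id
    change partialOp p (n + 1) _ (List.ofFn (oddDoublePrime p (n + 1))).prod = 0 at h2
    rw [partialOp_mul, prodPrimeOmit, partialOp_prod_oddPrime _ (by simp), h2, zero_mul,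
      mul_zero, add_zero]
  have h3 (α : Fin p) : partialOp p (n + 1) (Sum.inl (Sum.inr α)) (prodPrimeOmit p j) = 0 :=
    partialOp_prod_oddPrime _ (by simp) _
  rw [delOp_apply]
  congr 2
  · have key (μ : Fin (n + 1)) : oddPrime p (n + 1) μ * ((zmpp p (n + 1) j ⊗ₜ 1) *
        (prodPrimeOmit p j * (List.ofFn (oddDoublePrime p (n + 1))).prod))
        = if μ = j then (-1 : ℂ) ^ (j : ℕ) • ((zmpp p (n + 1) j ⊗ₜ 1) * phiF p (n + 1))
          else 0 := by
      rw [← mul_assoc, ← tmul_one_mul_comm, mul_assoc, ← mul_assoc (oddPrime _ _ _),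
        oddPrime_mul_prodPrimeOmit, phiF_eq]
      split_ifs
      · rw [smul_mul_assoc, mul_smul_comm]
      · rw [zero_mul, mul_zero]
    rw [Finset.sum_eq_single j (fun μ _ hμ => by rw [key, if_neg hμ, mul_zero]) (by simp), key,
      if_pos rfl, mul_smul_comm, ← mul_assoc, Algebra.TensorProduct.tmul_mul_tmul, one_mul,
      mul_comm (zmp _ _ _)]
  · refine Finset.sum_congr rfl fun α _ => ?_
    simp only [partialOp_zmpp_mul _ _ _ h]
    rw [Finset.sum_eq_single j (fun μ _ hμ => by simp [hμ]) (by simp), if_pos rfl,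
      partialOp_mul, h3, zero_mul, zero_add, mul_assoc]

theorem rTensor_Lop_phiF {n : ℕ} :
    LinearMap.rTensor (Lam p (n + 1)) (Lop p (n + 1)) (phiF p (n + 1))
      = -(4 * (Real.pi : ℂ)) • (∑ α,
          partialOp p (n + 1) (Sum.inl (Sum.inl α)) (List.ofFn (oddPrime p (n + 1))).prod *
          partialOp p (n + 1) (Sum.inl (Sum.inr α)) (List.ofFn (oddDoublePrime p (n + 1))).prod)
        + (1 / (4 * (Real.pi : ℂ))) •
          ∑ μ, ((zmpp p (n + 1) μ * zmp p (n + 1) μ) ⊗ₜ 1) * phiF p (n + 1) := by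
  have hP (i : PVar p (n + 1)) (hi : ∀ α, i ≠ Sum.inl (Sum.inl α)) :
      partialOp p (n + 1) i (List.ofFn (oddPrime p (n + 1))).prod = 0 :=
    partialOp_prod_oddPrime i hi id
  have hQ (i : PVar p (n + 1)) (hi : ∀ α, i ≠ Sum.inl (Sum.inr α)) :
      partialOp p (n + 1) i (List.ofFn (oddDoublePrime p (n + 1))).prod = 0 :=
    partialOp_prod_oddDoublePrime i hi id
  rw [rTensor_Lop]
  congr 2
  have h1 (μ : Fin (n + 1)) : partialOp p (n + 1) (Sum.inr (Sum.inl μ)) (phiF p (n + 1)) = 0 := by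
    rw [phiF_eq, partialOp_mul, hP _ (by simp), hQ _ (by simp)]
    simp
  simp only [h1, map_zero, Finset.sum_const_zero, add_zero]
  refine Finset.sum_congr rfl fun α _ => ?_
  rw [phiF_eq, partialOp_mul, hP _ (by simp), zero_mul, zero_add, partialOp_mul,
    partialOp_comm, hQ (Sum.inl (Sum.inl α)) (by simp)]
  simp

end Fock

/-- The Fock-model form of `ω(L) φ_KM = dd^c ψ`:  `L φ' = (−1)^{q−1} 4π ∂∂̄ ψ'`. -/
theorem statement10 (p q : ℕ) (hp : 1 ≤ p) (hq : 1 ≤ q) :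
    LinearMap.rTensor (Lam p q) (Lop p q) (phiF p q)
      = ((-1 : ℂ)^(q-1) * (4 * (Real.pi : ℂ))) • delOp p q (delBarOp p q (psiF p q)) := by
  obtain ⟨n, rfl⟩ : ∃ n, q = n + 1 := ⟨q - 1, by omega⟩
  have hpi : (4 * (Real.pi : ℂ)) ≠ 0 := by simp [Real.pi_ne_zero]
  have hn : ((-1 : ℂ) ^ n) * (-1) ^ n = 1 := by rw [← mul_pow]; simp
  have hc : (-1 : ℂ) ^ n * (4 * (Real.pi : ℂ)) * ((-1) ^ n * (1 / (4 * (Real.pi : ℂ)))) = 1 := by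
    rw [mul_mul_mul_comm, hn, mul_one_div_cancel hpi, one_mul]
  have hj (j : Fin (n + 1)) : ((-1 : ℂ) ^ (j : ℕ)) * (-1) ^ (j : ℕ) = 1 := by
    rw [← mul_pow]; simp
  rw [rTensor_Lop_phiF, delBarOp_psiF, map_smul, smul_smul, Nat.add_sub_cancel, hc, one_smul,
    map_sum]
  simp only [map_smul, delOp_zmpp_mul, smul_sub, Finset.sum_sub_distrib,
    partialOp_prod_oddPrime_eq_sum, Finset.sum_mul, smul_mul_assoc]
  refine (neg_smul_add_eq_sub _ _ _).trans ?_
  congr 1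
  · rw [Finset.smul_sum]
    refine Finset.sum_congr rfl fun j _ => ?_
    rw [smul_comm, smul_smul ((-1 : ℂ) ^ (j : ℕ)), hj, one_smul]
  · rw [Finset.sum_comm, Finset.smul_sum]
    refine Finset.sum_congr rfl fun j _ => ?_
    rw [smul_comm, ← Finset.smul_sum, smul_comm]
end
end
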